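/- arXiv:2204.02305 — 2 statements merged into one kernel-verified Lean document; each statement's English description precedes it below -/
import Mathlib

section
/- Let (T_1(t))_{t>0} and (T_2(t))_{t>0} be positive semigroups of kernel operators on a Polish space E, bounded by some constant M, and assume that T_j(t) maps C_b(E) into C_b(E) for all t > 0 and j = 1,2. Denote their Laplace transforms by (R_1(λ))_{λ>0} and (R_2(λ))_{λ>0}. Then the following are equivalent: (i) R_1(λ) ≤ R_2(λ) for all λ > 0; (ii) T_1(t) ≤ T_2(t) for all t > 0. -/
open MeasureTheory Filter Topology

/-- `f` is a bounded Borel measurable real-valued function. -/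
def IsBb {E : Type*} [MeasurableSpace E] (f : E → ℝ) : Prop :=
  Measurable f ∧ ∃ C : ℝ, ∀ x, |f x| ≤ C

/-- `f` is a bounded continuous real-valued function. -/
def IsCb {E : Type*} [TopologicalSpace E] (f : E → ℝ) : Prop :=
  Continuous f ∧ ∃ C : ℝ, ∀ x, |f x| ≤ C

/-- The kernel operator associated with a kernel `k : E → Measure E`. -/
noncomputable def kOp {E : Type*} [MeasurableSpace E] (k : E → Measure E) (f : E → ℝ) (x : E) : ℝ :=
  ∫ y, f y ∂(k x)

/-- `(k t)_{t>0}` is a positive semigroup of kernels on `E`, bounded by `M`: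
measurability in `x`, total mass bounded by `M`, Chapman–Kolmogorov, and joint
measurability of `(t,x) ↦ (T(t)f)(x)` on `(0,∞) × E` for bounded measurable `f`. -/
def IsKernelSemigroup {E : Type*} [MeasurableSpace E] (k : ℝ → E → Measure E) (M : NNReal) : Prop :=
  (∀ t, 0 < t → ∀ A : Set E, MeasurableSet A → Measurable fun x => k t x A) ∧
  (∀ t, 0 < t → ∀ x, k t x Set.univ ≤ (M : ENNReal)) ∧
  (∀ t, 0 < t → ∀ s, 0 < s → ∀ x, ∀ A : Set E, MeasurableSet A →
    k (t + s) x A = ∫⁻ y, k s y A ∂(k t x)) ∧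
  (∀ f : E → ℝ, IsBb f → Measurable fun p : Set.Ioi (0:ℝ) × E => kOp (k p.1.1) f p.2)

/-- The Laplace transform (pseudo-resolvent) of the semigroup of kernel operators. -/
noncomputable def laplaceOp {E : Type*} [MeasurableSpace E]
    (k : ℝ → E → Measure E) (l : ℝ) (f : E → ℝ) (x : E) : ℝ :=
  ∫ t in Set.Ioi (0:ℝ), Real.exp (-l * t) * kOp (k t) f x

open ProbabilityTheory
open scoped ENNReal NNReal BoundedContinuousFunction Nat

theorem measure_le_of_forall_lintegral_le {Ω : Type*} [TopologicalSpace Ω]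
    [TopologicalSpace.PseudoMetrizableSpace Ω] [MeasurableSpace Ω] [BorelSpace Ω]
    {μ ν : Measure Ω} [IsFiniteMeasure μ] [IsFiniteMeasure ν]
    (h : ∀ g : Ω →ᵇ ℝ≥0, ∫⁻ x, g x ∂μ ≤ ∫⁻ x, g x ∂ν) : μ ≤ ν := by
  refine Measure.le_iff.2 fun A hA => ?_
  rw [hA.measure_eq_iSup_isClosed_of_ne_top (measure_ne_top μ A)]
  refine iSup₂_le fun F hFA => iSup_le fun hF => ?_
  exact (le_of_tendsto_of_tendsto' (HasOuterApproxClosed.tendsto_lintegral_apprSeq hF μ)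
    (HasOuterApproxClosed.tendsto_lintegral_apprSeq hF ν) fun n => h _).trans (measure_mono hFA)

theorem measure_le_of_forall_finite_sUnion_countableBasis_le {Ω : Type*} [TopologicalSpace Ω]
    [TopologicalSpace.PseudoMetrizableSpace Ω] [SecondCountableTopology Ω]
    [MeasurableSpace Ω] [BorelSpace Ω] {μ ν : Measure Ω} [IsFiniteMeasure ν]
    (h : ∀ T : Set (Set Ω), T.Finite → T ⊆ TopologicalSpace.countableBasis Ω →
      μ (⋃₀ T) ≤ ν (⋃₀ T)) : μ ≤ ν := by
  have hopen : ∀ U, IsOpen U → μ U ≤ ν U := by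
    intro U hU
    obtain ⟨S, hS, rfl⟩ :=
      (TopologicalSpace.isBasis_countableBasis Ω).open_eq_sUnion hU
    rcases S.eq_empty_or_nonempty with rfl | hne
    · simp
    obtain ⟨f, rfl⟩ :=
      ((TopologicalSpace.countable_countableBasis Ω).mono hS).exists_eq_range hne
    rw [Set.sUnion_range, measure_iUnion_eq_iSup_accumulate]
    refine iSup_le fun n => ?_
    have key := h (f '' Set.Iic n) ((Set.finite_Iic n).image f)
      ((Set.image_subset_range _ _).trans hS)
    have hacc : ⋃₀ (f '' Set.Iic n) = Set.accumulate f n := by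
      simp [Set.sUnion_image, Set.accumulate_def]
    rw [hacc] at key
    exact key.trans (measure_mono (Set.accumulate_subset_iUnion n))
  refine Measure.le_iff.2 fun A _ => ?_
  rw [A.measure_eq_iInf_isOpen ν]
  exact le_iInf₂ fun U hAU => le_iInf fun hU => (measure_mono hAU).trans (hopen U hU)

theorem tendsto_lintegral_rescaled_poissonMeasure (t : ℝ≥0) (g : ℝ →ᵇ ℝ≥0) :
    Tendsto (fun m : ℕ => ∫⁻ k : ℕ, g ((m + 1 : ℝ)⁻¹ * k) ∂poissonMeasure ((m + 1) * t))
      atTop (𝓝 (g t)) := by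
  let P : ℕ → ProbabilityMeasure ℝ := fun m =>
    ⟨((poissonMeasure ((m + 1) * t)).map (Nat.cast : ℕ → ℝ)).map ((m + 1 : ℝ)⁻¹ * ·),
      Measure.isProbabilityMeasure_map (by fun_prop)⟩
  have hP : Tendsto P atTop (𝓝 ⟨Measure.dirac (t : ℝ), inferInstance⟩) := by
    refine ProbabilityMeasure.tendsto_iff_tendsto_charFun.2 fun u => ?_
    simp only [P, ProbabilityMeasure.coe_mk, charFun_map_mul, charFun_map_cast_poissonMeasure,
      charFun_dirac]
    have hd : HasDerivAt (fun v : ℝ => Complex.exp (v * (u * Complex.I))) (u * Complex.I) 0 := by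
      have := ((hasDerivAt_id (0 : ℝ)).ofReal_comp.mul_const (u * Complex.I)).cexp
      simpa using this
    have hs := hasDerivAt_iff_tendsto_slope_zero.1 hd
    have hm : Tendsto (fun m : ℕ => (m + 1 : ℝ)⁻¹) atTop (𝓝[≠] 0) := by
      refine tendsto_nhdsWithin_iff.2 ⟨?_, Eventually.of_forall fun m => ?_⟩
      · simpa using tendsto_one_div_add_atTop_nhds_zero_nat (𝕜 := ℝ)
      · exact inv_ne_zero (by positivity)
    have hlim := ((hs.comp hm).const_mul (t : ℂ)).cexp
    refine (hlim.congr fun m => ?_).trans_eq ?_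
    · congr 1
      simp
      ring_nf
    · congr 2
      simp only [real_inner_comm, Real.inner_apply]
      push_cast
      ring
  have := (ProbabilityMeasure.tendsto_iff_forall_lintegral_tendsto.1 hP) g
  simp only [P, ProbabilityMeasure.coe_mk] at this
  rw [lintegral_dirac] at this
  refine this.congr fun m => ?_
  rw [lintegral_map (by fun_prop) (by fun_prop), lintegral_map (by fun_prop) (by fun_prop)]

theorem lintegral_poissonMeasure (r : ℝ≥0) (f : ℕ → ℝ≥0∞) :
    ∫⁻ k, f k ∂poissonMeasure r =
      ∑' k, ENNReal.ofReal (Real.exp (-r) * r ^ k / k !) * f k := by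
  simp [poissonMeasure, lintegral_sum_measure]

/-- The Erlang-type weight `t ↦ exp (-l t) t ^ n / n!`. -/
noncomputable def erlangWeight (l : ℝ) (n : ℕ) (t : ℝ) : ℝ≥0∞ :=
  ENNReal.ofReal (Real.exp (-l * t) * t ^ n / n !)

@[fun_prop]
theorem measurable_erlangWeight (l : ℝ) (n : ℕ) : Measurable (erlangWeight l n) := by
  unfold erlangWeight; fun_prop

theorem ae_le_of_forall_lintegral_erlangWeight_le {F G : ℝ → ℝ≥0∞} (hF : Measurable F)
    (hG : Measurable G) (C : ℝ≥0) (hFC : ∀ t, F t ≤ C) (hGC : ∀ t, G t ≤ C)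
    (h : ∀ l, 0 < l → ∀ n, ∫⁻ t in Set.Ioi 0, erlangWeight l n t * F t ≤
      ∫⁻ t in Set.Ioi 0, erlangWeight l n t * G t) :
    ∀ᵐ t ∂volume.restrict (Set.Ioi (0 : ℝ)), F t ≤ G t := by
  let e : ℝ → ℝ≥0∞ := erlangWeight 1 0
  have he : Measurable e := measurable_erlangWeight 1 0
  have hfin : ∀ H : ℝ → ℝ≥0∞, Measurable H → (∀ t, H t ≤ C) →
      IsFiniteMeasure ((volume.restrict (Set.Ioi (0 : ℝ))).withDensity (fun t => e t * H t)) := by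
    intro H hH hHC
    refine isFiniteMeasure_withDensity (ne_of_lt ?_)
    calc ∫⁻ t in Set.Ioi 0, e t * H t ≤ ∫⁻ t in Set.Ioi 0, e t * C :=
          lintegral_mono fun t => by gcongr; exact hHC t
      _ = (∫⁻ t in Set.Ioi 0, e t) * C := lintegral_mul_const _ he
      _ < ∞ := by
        refine ENNReal.mul_lt_top ?_ ENNReal.coe_lt_top
        have : IntegrableOn (fun t : ℝ => Real.exp (-1 * t)) (Set.Ioi 0) :=
          integrableOn_exp_mul_Ioi (by norm_num) 0
        simpa [e, erlangWeight] using this.lintegral_lt_top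
  have := hfin F hF hFC
  have := hfin G hG hGC
  set μ := (volume.restrict (Set.Ioi (0 : ℝ))).withDensity (fun t => e t * F t) with hμ
  set ν := (volume.restrict (Set.Ioi (0 : ℝ))).withDensity (fun t => e t * G t) with hν
  let S : (ℝ →ᵇ ℝ≥0) → ℕ → ℝ → ℝ≥0∞ := fun g m t =>
    ∫⁻ k : ℕ, g ((m + 1 : ℝ)⁻¹ * k) ∂poissonMeasure ((m + 1) * t.toNNReal)
  have hSm : ∀ g m, Measurable (S g m) := by
    intro g m
    simp only [S, lintegral_poissonMeasure]
    fun_prop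
  have hexp : ∀ H : ℝ → ℝ≥0∞, Measurable H → ∀ (g : ℝ →ᵇ ℝ≥0) (m : ℕ),
      ∫⁻ t, S g m t ∂(volume.restrict (Set.Ioi (0 : ℝ))).withDensity (fun t => e t * H t) =
      ∑' k : ℕ, (g ((m + 1 : ℝ)⁻¹ * k) * (m + 1) ^ k) *
        ∫⁻ t in Set.Ioi 0, erlangWeight (m + 2) k t * H t := by
    intro H hH g m
    rw [lintegral_withDensity_eq_lintegral_mul _ (by fun_prop) (hSm g m)]
    rw [tsum_congr fun k => (lintegral_const_mul _ (by fun_prop)).symm]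
    rw [← lintegral_tsum (fun k => by fun_prop)]
    refine setLIntegral_congr_fun measurableSet_Ioi fun t ht => ?_
    have ht : 0 < t := ht
    simp only [S, lintegral_poissonMeasure, Pi.mul_apply]
    rw [← ENNReal.tsum_mul_left]
    congr with k
    have hm : ((m : ℝ≥0∞) + 1) ^ k = ENNReal.ofReal ((m + 1 : ℝ) ^ k) := by
      rw [ENNReal.ofReal_pow (by positivity), ENNReal.ofReal_add (by positivity) (by norm_num)]
      simp
    have key : e t * ENNReal.ofReal (Real.exp (-(((m : ℝ≥0) + 1) * t.toNNReal : ℝ≥0)) *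
        (((m : ℝ≥0) + 1) * t.toNNReal : ℝ≥0) ^ k / k !) =
        ((m : ℝ≥0∞) + 1) ^ k * erlangWeight (m + 2) k t := by
      simp only [e, erlangWeight]
      rw [hm, ← ENNReal.ofReal_mul (by positivity), ← ENNReal.ofReal_mul (by positivity)]
      congr 1
      push_cast [Real.coe_toNNReal t ht.le]
      have : Real.exp (-((m : ℝ) + 2) * t) =
          Real.exp (-1 * t) * Real.exp (-(((m : ℝ) + 1) * t)) := by
        rw [← Real.exp_add]; congr 1; ring
      rw [this]
      simp [mul_pow]
      ring
    calc _ = (e t * ENNReal.ofReal (Real.exp (-(((m : ℝ≥0) + 1) * t.toNNReal : ℝ≥0)) *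
        (((m : ℝ≥0) + 1) * t.toNNReal : ℝ≥0) ^ k / k !)) * H t * g ((m + 1 : ℝ)⁻¹ * k) := by ring
      _ = _ := by rw [key]; ring
  have hlim : ∀ H : ℝ → ℝ≥0∞, Measurable H → (∀ t, H t ≤ C) → ∀ g : ℝ →ᵇ ℝ≥0,
      Tendsto (fun m => ∫⁻ t, S g m t
        ∂(volume.restrict (Set.Ioi (0 : ℝ))).withDensity (fun t => e t * H t)) atTop
        (𝓝 (∫⁻ t, g t
        ∂(volume.restrict (Set.Ioi (0 : ℝ))).withDensity (fun t => e t * H t))) := by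
    intro H hH hHC g
    have := hfin H hH hHC
    refine tendsto_lintegral_of_dominated_convergence (fun _ => ((nndist g 0 : ℝ≥0) : ℝ≥0∞))
      (hSm g) (fun m => Eventually.of_forall fun t => ?_) ?_ ?_
    · calc S g m t ≤ ∫⁻ k : ℕ, (nndist g 0 : ℝ≥0) ∂poissonMeasure ((m + 1) * t.toNNReal) :=
            lintegral_mono fun k =>
              ENNReal.coe_le_coe.2 (BoundedContinuousFunction.NNReal.upper_bound g _)
        _ = _ := by simp
    · rw [lintegral_const]
      exact ENNReal.mul_ne_top ENNReal.coe_ne_top (measure_ne_top _ _)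
    · refine (withDensity_absolutelyContinuous _ _).ae_le ?_
      filter_upwards [ae_restrict_mem measurableSet_Ioi] with t ht
      have := tendsto_lintegral_rescaled_poissonMeasure t.toNNReal g
      rwa [Real.coe_toNNReal t (le_of_lt ht)] at this
  have hle : μ ≤ ν := by
    refine measure_le_of_forall_lintegral_le fun g => ?_
    refine le_of_tendsto_of_tendsto' (hlim F hF hFC g) (hlim G hG hGC g) fun m => ?_
    rw [hexp F hF, hexp G hG]
    refine ENNReal.tsum_le_tsum fun k => ?_
    exact mul_le_mul' le_rfl (h ((m : ℝ) + 2) (by positivity) k)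
  have hae := ae_le_of_forall_setLIntegral_le_of_sigmaFinite
    (μ := volume.restrict (Set.Ioi (0 : ℝ))) (he.mul hF) (g := fun t => e t * G t)
    fun s hs _ => by
      have := hle s
      rwa [hμ, hν, withDensity_apply _ hs, withDensity_apply _ hs] at this
  filter_upwards [hae] with t ht
  refine (ENNReal.mul_le_mul_iff_right ?_ ?_).1 ht
  · simp [e, erlangWeight, Real.exp_pos]
  · simp [e, erlangWeight]

theorem lintegral_erlangWeight_convolution (l : ℝ) (n : ℕ) (u : ℝ) :
    ∫⁻ s, (Set.Ioi 0).indicator (erlangWeight l 0) s *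
      (Set.Ioi 0).indicator (erlangWeight l n) (u - s) =
      (Set.Ioi 0).indicator (erlangWeight l (n + 1)) u := by
  have hind : ∀ s, (Set.Ioi 0).indicator (erlangWeight l 0) s *
      (Set.Ioi 0).indicator (erlangWeight l n) (u - s) =
      (Set.Ioo 0 u).indicator
        (fun s => ENNReal.ofReal (Real.exp (-l * u) * (u - s) ^ n / n !)) s := by
    intro s
    by_cases hs : 0 < s <;> by_cases hu : s < u <;> simp [hs, hu]
    simp only [erlangWeight]
    rw [← ENNReal.ofReal_mul (by positivity)]
    congr 1
    have : Real.exp (-l * u) = Real.exp (-l * s) * Real.exp (-l * (u - s)) := by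
      rw [← Real.exp_add]; congr 1; ring
    rw [show -(l * u) = -l * u by ring, this]
    simp
    ring
  simp_rw [hind]
  rw [lintegral_indicator measurableSet_Ioo]
  rcases le_or_gt u 0 with hu | hu
  · simp [hu]
  · rw [Set.indicator_of_mem (Set.mem_Ioi.2 hu), setLIntegral_congr Ioo_ae_eq_Ioc,
      ← ofReal_integral_eq_lintegral_ofReal]
    · rw [← intervalIntegral.integral_of_le hu.le]
      simp only [erlangWeight]
      congr 1
      simp_rw [mul_div_assoc]
      rw [intervalIntegral.integral_const_mul, intervalIntegral.integral_div,
        intervalIntegral.integral_comp_sub_left (fun x => x ^ n) u, integral_pow,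
        Nat.factorial_succ]
      push_cast
      field_simp
      simp
    · exact (Continuous.integrableOn_Icc (by fun_prop)).mono_set Set.Ioc_subset_Icc_self
    · filter_upwards [ae_restrict_mem measurableSet_Ioc] with s hs
      have : 0 ≤ u - s := sub_nonneg.2 hs.2
      simp only [Pi.zero_apply]
      positivity

section Kernel

variable {E : Type*} [MeasurableSpace E]

/-- The functional `∫₀^∞ exp (-l t) t ^ n / n! (T(t) f)(x) dt` of a kernel on `ℝ × E`. -/
noncomputable def erlangOp (κ : Kernel (ℝ × E) E) (l : ℝ) (n : ℕ) (f : E → ℝ≥0∞) (x : E) :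
    ℝ≥0∞ :=
  ∫⁻ t in Set.Ioi 0, erlangWeight l n t * ∫⁻ y, f y ∂κ (t, x)

theorem measurable_erlangOp (κ : Kernel (ℝ × E) E) (l : ℝ) (n : ℕ) {f : E → ℝ≥0∞}
    (hf : Measurable f) : Measurable (erlangOp κ l n f) := by
  have hK : Measurable fun p : ℝ × E => ∫⁻ y, f y ∂κ p := hf.lintegral_kernel
  have : Measurable fun p : E × ℝ => erlangWeight l n p.2 * ∫⁻ y, f y ∂κ (p.2, p.1) :=
    ((measurable_erlangWeight l n).comp measurable_snd).mul (hK.comp measurable_swap)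
  exact this.lintegral_prod_right'

theorem erlangOp_zero_erlangOp {κ : Kernel (ℝ × E) E} [IsFiniteKernel κ]
    (hκ : ∀ s, 0 < s → ∀ t, 0 < t → ∀ x, κ (s + t, x) = (κ (s, x)).bind fun y => κ (t, y))
    (l : ℝ) (n : ℕ) {f : E → ℝ≥0∞} (hf : Measurable f) (x : E) :
    erlangOp κ l 0 (erlangOp κ l n f) x = erlangOp κ l (n + 1) f x := by
  have hK : Measurable fun p : ℝ × E => ∫⁻ y, f y ∂κ p := hf.lintegral_kernel
  have hKx : Measurable fun t : ℝ => ∫⁻ y, f y ∂κ (t, x) :=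
    hK.comp (measurable_id.prodMk measurable_const)
  have hW : ∀ n, Measurable ((Set.Ioi 0).indicator (erlangWeight l n)) := fun n =>
    (measurable_erlangWeight l n).indicator measurableSet_Ioi
  have hind : ∀ n (H : ℝ → ℝ≥0∞), ∫⁻ t in Set.Ioi 0, erlangWeight l n t * H t =
      ∫⁻ t, (Set.Ioi 0).indicator (erlangWeight l n) t * H t := by
    intro n H
    rw [← lintegral_indicator measurableSet_Ioi]
    simp_rw [Set.indicator_mul_left]
  have hinner : ∀ s, 0 < s → ∫⁻ y, erlangOp κ l n f y ∂κ (s, x) =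
      ∫⁻ u, (Set.Ioi 0).indicator (erlangWeight l n) (u - s) * ∫⁻ y, f y ∂κ (u, x) := by
    intro s hs
    simp only [erlangOp]
    rw [lintegral_lintegral_swap]
    · have : ∀ t ∈ Set.Ioi (0 : ℝ), ∫⁻ y, erlangWeight l n t * ∫⁻ z, f z ∂κ (t, y) ∂κ (s, x) =
          erlangWeight l n t * ∫⁻ y, f y ∂κ (s + t, x) := by
        intro t ht
        have hm : Measurable fun y => κ (t, y) :=
          κ.measurable.comp (measurable_const.prodMk measurable_id)
        have hKt : Measurable fun y => ∫⁻ z, f z ∂κ (t, y) :=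
          hK.comp (measurable_const.prodMk measurable_id)
        rw [lintegral_const_mul _ hKt,
          hκ s hs t ht, Measure.lintegral_bind hm.aemeasurable hf.aemeasurable]
      rw [setLIntegral_congr_fun measurableSet_Ioi this, hind,
        ← lintegral_sub_right_eq_self _ s]
      simp
    · refine Measurable.aemeasurable ?_
      exact ((measurable_erlangWeight l n).comp measurable_snd).mul (hK.comp measurable_swap)
  have houter : erlangOp κ l 0 (erlangOp κ l n f) x =
      ∫⁻ s, ∫⁻ u, (Set.Ioi 0).indicator (erlangWeight l 0) s *
        (Set.Ioi 0).indicator (erlangWeight l n) (u - s) * ∫⁻ y, f y ∂κ (u, x) := by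
    rw [erlangOp, hind]
    congr with s
    by_cases hs : 0 < s
    · rw [hinner s hs, ← lintegral_const_mul]
      · simp_rw [mul_assoc]
      · exact ((hW n).comp (by fun_prop)).mul hKx
    · simp [hs]
  rw [houter, lintegral_lintegral_swap]
  · rw [erlangOp, hind]
    congr with u
    rw [lintegral_mul_const, lintegral_erlangWeight_convolution]
    exact (hW 0).mul ((hW n).comp (by fun_prop))
  · refine Measurable.aemeasurable ?_
    exact (((hW 0).comp measurable_fst).mul ((hW n).comp (by fun_prop))).mul
      (hKx.comp measurable_snd)

theorem erlangOp_mono_right (κ : Kernel (ℝ × E) E) (l : ℝ) (n : ℕ) {f g : E → ℝ≥0∞}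
    (h : ∀ x, f x ≤ g x) (x : E) : erlangOp κ l n f x ≤ erlangOp κ l n g x :=
  lintegral_mono fun _ => mul_le_mul' le_rfl (lintegral_mono h)

theorem erlangOp_le_of_zero_le {κ₁ κ₂ : Kernel (ℝ × E) E} [IsFiniteKernel κ₁] [IsFiniteKernel κ₂]
    (hκ₁ : ∀ s, 0 < s → ∀ t, 0 < t → ∀ x, κ₁ (s + t, x) = (κ₁ (s, x)).bind fun y => κ₁ (t, y))
    (hκ₂ : ∀ s, 0 < s → ∀ t, 0 < t → ∀ x, κ₂ (s + t, x) = (κ₂ (s, x)).bind fun y => κ₂ (t, y))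
    {l : ℝ} (h : ∀ f, Measurable f → ∀ x, erlangOp κ₁ l 0 f x ≤ erlangOp κ₂ l 0 f x)
    (n : ℕ) {f : E → ℝ≥0∞} (hf : Measurable f) (x : E) :
    erlangOp κ₁ l n f x ≤ erlangOp κ₂ l n f x := by
  induction n generalizing x with
  | zero => exact h f hf x
  | succ n ih =>
    rw [← erlangOp_zero_erlangOp hκ₁ l n hf, ← erlangOp_zero_erlangOp hκ₂ l n hf]
    exact (erlangOp_mono_right κ₁ l 0 ih x).trans (h _ (measurable_erlangOp κ₂ l n hf) x)

theorem erlangOp_eq_lintegral_bind (κ : Kernel (ℝ × E) E) (l : ℝ) (n : ℕ) {f : E → ℝ≥0∞}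
    (hf : Measurable f) (x : E) :
    erlangOp κ l n f x = ∫⁻ y, f y ∂((volume.restrict (Set.Ioi 0)).withDensity
      (erlangWeight l n)).bind fun t => κ (t, x) := by
  have hm : Measurable fun t => κ (t, x) :=
    κ.measurable.comp (measurable_id.prodMk measurable_const)
  have hK : Measurable fun p : ℝ × E => ∫⁻ y, f y ∂κ p := hf.lintegral_kernel
  have hKx : Measurable fun t : ℝ => ∫⁻ y, f y ∂κ (t, x) :=
    hK.comp (measurable_id.prodMk measurable_const)
  rw [Measure.lintegral_bind hm.aemeasurable hf.aemeasurable,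
    lintegral_withDensity_eq_lintegral_mul _ (by fun_prop) hKx]
  rfl

theorem erlangOp_le_of_forall_indicator_le {κ₁ κ₂ : Kernel (ℝ × E) E} {l : ℝ} {n : ℕ} {x : E}
    (h : ∀ A, MeasurableSet A →
      erlangOp κ₁ l n (A.indicator 1) x ≤ erlangOp κ₂ l n (A.indicator 1) x)
    {f : E → ℝ≥0∞} (hf : Measurable f) : erlangOp κ₁ l n f x ≤ erlangOp κ₂ l n f x := by
  rw [erlangOp_eq_lintegral_bind κ₁ l n hf, erlangOp_eq_lintegral_bind κ₂ l n hf]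
  refine lintegral_mono' (Measure.le_iff.2 fun A hA => ?_) le_rfl
  have := h A hA
  rwa [erlangOp_eq_lintegral_bind κ₁ l n (measurable_one.indicator hA),
    erlangOp_eq_lintegral_bind κ₂ l n (measurable_one.indicator hA),
    lintegral_indicator_one hA, lintegral_indicator_one hA] at this

end Kernel

namespace IsKernelSemigroup

variable {E : Type*} [MeasurableSpace E] {k : ℝ → E → Measure E} {M : NNReal}

theorem isFiniteMeasure (h : IsKernelSemigroup k M) {t : ℝ} (ht : 0 < t) (x : E) :
    IsFiniteMeasure (k t x) :=
  ⟨(h.2.1 t ht x).trans_lt ENNReal.coe_lt_top⟩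

open Classical in
/-- The semigroup as a single kernel on `ℝ × E`, extended by zero to nonpositive times. -/
noncomputable def toKernel (h : IsKernelSemigroup k M) : Kernel (ℝ × E) E where
  toFun p := if 0 < p.1 then k p.1 p.2 else 0
  measurable' := by
    refine Measure.measurable_of_measurable_coe _ fun A hA => ?_
    have hs : MeasurableSet {p : ℝ × E | 0 < p.1} := measurableSet_lt measurable_const measurable_fst
    refine measurable_of_restrict_of_restrict_compl hs ?_ ?_
    · have hb : IsBb (A.indicator (1 : E → ℝ)) :=
        ⟨measurable_one.indicator hA, 1, fun x => by
          by_cases hx : x ∈ A <;> simp [hx]⟩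
      have hm : Measurable fun p : {p : ℝ × E | 0 < p.1} =>
          ((⟨p.1.1, p.2⟩, p.1.2) : Set.Ioi (0 : ℝ) × E) := by
        fun_prop
      have := ((h.2.2.2 _ hb).comp hm).ennreal_ofReal
      convert! this using 1
      funext p
      have hp : 0 < p.1.1 := p.2
      have := h.isFiniteMeasure hp p.1.2
      simp [kOp, integral_indicator_one hA, hp, Set.domRestrict]
    · convert! measurable_const (a := (0 : ℝ≥0∞)) using 1
      funext p
      have hp : ¬ 0 < p.1.1 := p.2
      simp [hp, Set.domRestrict]

theorem toKernel_apply (h : IsKernelSemigroup k M) {t : ℝ} (ht : 0 < t) (x : E) :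
    h.toKernel (t, x) = k t x := by
  simp [toKernel, ht]

theorem toKernel_univ_le (h : IsKernelSemigroup k M) (p : ℝ × E) :
    h.toKernel p Set.univ ≤ M := by
  by_cases hp : 0 < p.1
  · rw [show p = (p.1, p.2) from rfl, h.toKernel_apply hp]
    exact h.2.1 _ hp _
  · simp [toKernel, hp]

instance (h : IsKernelSemigroup k M) : IsFiniteKernel h.toKernel :=
  ⟨⟨M, ENNReal.coe_lt_top, h.toKernel_univ_le⟩⟩

theorem toKernel_add (h : IsKernelSemigroup k M) (s : ℝ) (hs : 0 < s) (t : ℝ) (ht : 0 < t)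
    (x : E) : h.toKernel (s + t, x) = (h.toKernel (s, x)).bind fun y => h.toKernel (t, y) := by
  have hm : Measurable fun y => h.toKernel (t, y) :=
    h.toKernel.measurable.comp (measurable_const.prodMk measurable_id)
  ext A hA
  rw [Measure.bind_apply hA hm.aemeasurable, h.toKernel_apply (add_pos hs ht),
    h.2.2.1 s hs t ht x A hA, h.toKernel_apply hs]
  simp_rw [h.toKernel_apply ht]

theorem erlangOp_toKernel_ne_top (h : IsKernelSemigroup k M) {l : ℝ} (hl : 0 < l)
    {f : E → ℝ} (hf : IsBb f) (x : E) :
    erlangOp h.toKernel l 0 (fun y => ENNReal.ofReal (f y)) x ≠ ∞ := by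
  obtain ⟨C, hC⟩ := hf.2
  have hw : ∫⁻ t in Set.Ioi 0, erlangWeight l 0 t < ∞ := by
    have : IntegrableOn (fun t : ℝ => Real.exp (-l * t)) (Set.Ioi 0) :=
      integrableOn_exp_mul_Ioi (neg_lt_zero.2 hl) 0
    simpa [erlangWeight] using this.lintegral_lt_top
  refine ne_of_lt ?_
  calc erlangOp h.toKernel l 0 (fun y => ENNReal.ofReal (f y)) x
      ≤ ∫⁻ t in Set.Ioi 0, erlangWeight l 0 t * (ENNReal.ofReal C * M) := by
        refine lintegral_mono fun t => mul_le_mul' le_rfl ?_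
        calc ∫⁻ y, ENNReal.ofReal (f y) ∂h.toKernel (t, x)
            ≤ ∫⁻ _, ENNReal.ofReal C ∂h.toKernel (t, x) :=
              lintegral_mono fun y => ENNReal.ofReal_le_ofReal ((le_abs_self _).trans (hC y))
          _ ≤ ENNReal.ofReal C * M := by
              rw [lintegral_const]
              exact mul_le_mul' le_rfl (h.toKernel_univ_le _)
    _ = (∫⁻ t in Set.Ioi 0, erlangWeight l 0 t) * (ENNReal.ofReal C * M) :=
        lintegral_mul_const _ (by fun_prop)
    _ < ∞ := ENNReal.mul_lt_top hw (ENNReal.mul_lt_top ENNReal.ofReal_lt_top ENNReal.coe_lt_top)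

theorem laplaceOp_eq_toReal_erlangOp (h : IsKernelSemigroup k M) (l : ℝ)
    {f : E → ℝ} (hf : IsBb f) (hf0 : ∀ x, 0 ≤ f x) (x : E) :
    laplaceOp k l f x =
      (erlangOp h.toKernel l 0 (fun y => ENNReal.ofReal (f y)) x).toReal := by
  obtain ⟨C, hC⟩ := hf.2
  have hint : ∀ t, Integrable f (h.toKernel (t, x)) := fun t =>
    Integrable.of_bound hf.1.aestronglyMeasurable C (Eventually.of_forall hC)
  have hof : ∀ t, ENNReal.ofReal (∫ y, f y ∂h.toKernel (t, x)) =
      ∫⁻ y, ENNReal.ofReal (f y) ∂h.toKernel (t, x) := fun t =>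
    ofReal_integral_eq_lintegral_ofReal (hint t) (Eventually.of_forall hf0)
  have hK : Measurable fun p : ℝ × E => ∫⁻ y, ENNReal.ofReal (f y) ∂h.toKernel p :=
    hf.1.ennreal_ofReal.lintegral_kernel
  have hKx : Measurable fun t : ℝ => ∫ y, f y ∂h.toKernel (t, x) := by
    have : Measurable fun t : ℝ => ∫⁻ y, ENNReal.ofReal (f y) ∂h.toKernel (t, x) :=
      hK.comp (measurable_id.prodMk measurable_const)
    convert! this.ennreal_toReal using 1
    funext t
    rw [← hof, ENNReal.toReal_ofReal (integral_nonneg hf0)]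
  have hk : laplaceOp k l f x =
      ∫ t in Set.Ioi (0 : ℝ), Real.exp (-l * t) * ∫ y, f y ∂h.toKernel (t, x) := by
    refine setIntegral_congr_fun measurableSet_Ioi fun t ht => ?_
    simp only [kOp, h.toKernel_apply (Set.mem_Ioi.1 ht)]
  rw [hk, integral_eq_lintegral_of_nonneg_ae
    (Eventually.of_forall fun t => mul_nonneg (Real.exp_pos _).le (integral_nonneg hf0))
    (Measurable.aestronglyMeasurable (by fun_prop))]
  congr 1
  refine lintegral_congr fun t => ?_
  rw [ENNReal.ofReal_mul (Real.exp_pos _).le, hof]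
  simp [erlangWeight]

end IsKernelSemigroup

theorem exists_pos_add_eq_of_ae_Ioi {P : ℝ → Prop}
    (hP : ∀ᵐ s ∂volume.restrict (Set.Ioi (0 : ℝ)), P s) {t : ℝ} (ht : 0 < t) :
    ∃ r s, 0 < r ∧ 0 < s ∧ r + s = t ∧ P r ∧ P s := by
  have h1 := (ae_restrict_iff' measurableSet_Ioi).1 hP
  have h2 := (Measure.measurePreserving_sub_left volume t).quasiMeasurePreserving.ae h1
  have : NeBot (ae (volume.restrict (Set.Ioo 0 t))) := by
    rw [ae_neBot, Ne, Measure.restrict_eq_zero]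
    simp [ht]
  obtain ⟨s, ⟨h1s, h2s⟩, hs⟩ := (((ae_restrict_of_ae h1).and (ae_restrict_of_ae h2)).and
    (ae_restrict_mem (measurableSet_Ioo (a := (0 : ℝ)) (b := t)))).exists
  exact ⟨s, t - s, hs.1, sub_pos.2 hs.2, by ring, h1s hs.1, h2s (sub_pos.2 hs.2)⟩

theorem measure_le_of_dense {E : Type*} [TopologicalSpace E]
    [TopologicalSpace.PseudoMetrizableSpace E] [MeasurableSpace E] [BorelSpace E]
    {κ₁ κ₂ : E → Measure E} [∀ x, IsFiniteMeasure (κ₁ x)] [∀ x, IsFiniteMeasure (κ₂ x)]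
    (hc₁ : ∀ f : E → ℝ, IsCb f → IsCb (kOp κ₁ f)) (hc₂ : ∀ f : E → ℝ, IsCb f → IsCb (kOp κ₂ f))
    {D : Set E} (hD : Dense D) (h : ∀ y ∈ D, κ₁ y ≤ κ₂ y) (x : E) : κ₁ x ≤ κ₂ x := by
  refine measure_le_of_forall_lintegral_le fun g => ?_
  have hg : IsCb fun y => (g y : ℝ) :=
    ⟨by fun_prop, nndist g 0, fun y => by
      rw [NNReal.abs_eq]
      exact NNReal.coe_le_coe.2 (BoundedContinuousFunction.NNReal.upper_bound g y)⟩
  obtain ⟨C, hC⟩ := hg.2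
  have hint : ∀ μ : Measure E, IsFiniteMeasure μ → Integrable (fun y => (g y : ℝ)) μ := fun μ _ =>
    Integrable.of_bound hg.1.aestronglyMeasurable C (Eventually.of_forall hC)
  have hle : kOp κ₁ (fun y => (g y : ℝ)) x ≤ kOp κ₂ (fun y => (g y : ℝ)) x := by
    have hcl : IsClosed {y | kOp κ₁ (fun y => (g y : ℝ)) y ≤ kOp κ₂ (fun y => (g y : ℝ)) y} :=
      isClosed_le (hc₁ _ hg).1 (hc₂ _ hg).1
    refine hcl.closure_subset_iff.2 (fun y hy => ?_) (hD x)
    exact integral_mono_measure (h y hy) (Eventually.of_forall fun _ => NNReal.coe_nonneg _)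
      (hint _ inferInstance)
  rw [lintegral_coe_eq_integral _ (hint _ inferInstance),
    lintegral_coe_eq_integral _ (hint _ inferInstance)]
  exact ENNReal.ofReal_le_ofReal hle

/-- Domination of two bounded positive semigroups of kernel operators (leaving
`C_b(E)` invariant) is equivalent to the domination of their Laplace transforms. -/
theorem laplace_domination_iff_semigroup_domination
    {E : Type*} [TopologicalSpace E] [PolishSpace E] [MeasurableSpace E] [BorelSpace E]
    (k₁ k₂ : ℝ → E → Measure E) (M : NNReal)
    (h₁ : IsKernelSemigroup k₁ M) (h₂ : IsKernelSemigroup k₂ M)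
    (hc₁ : ∀ t, 0 < t → ∀ f : E → ℝ, IsCb f → IsCb (kOp (k₁ t) f))
    (hc₂ : ∀ t, 0 < t → ∀ f : E → ℝ, IsCb f → IsCb (kOp (k₂ t) f)) :
    (∀ l : ℝ, 0 < l → ∀ f : E → ℝ, IsBb f → (∀ x, 0 ≤ f x) →
        ∀ x, laplaceOp k₁ l f x ≤ laplaceOp k₂ l f x) ↔
      (∀ t, 0 < t → ∀ x, ∀ A : Set E, MeasurableSet A → k₁ t x A ≤ k₂ t x A) := by
  constructor
  · intro h
    set κ₁ := h₁.toKernel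
    set κ₂ := h₂.toKernel
    have hzero : ∀ l, 0 < l → ∀ f, Measurable f → ∀ x,
        erlangOp κ₁ l 0 f x ≤ erlangOp κ₂ l 0 f x := by
      intro l hl f hf x
      refine erlangOp_le_of_forall_indicator_le (fun A hA => ?_) hf
      have hb : IsBb (A.indicator (1 : E → ℝ)) :=
        ⟨measurable_one.indicator hA, 1, fun x => by by_cases hx : x ∈ A <;> simp [hx]⟩
      have h0 : ∀ x, 0 ≤ A.indicator (1 : E → ℝ) x := fun x =>
        Set.indicator_nonneg (fun _ _ => zero_le_one) x
      have hA' : (A.indicator 1 : E → ℝ≥0∞) =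
          fun y => ENNReal.ofReal (A.indicator (1 : E → ℝ) y) := by
        ext y; by_cases hy : y ∈ A <;> simp [hy]
      have := h l hl _ hb h0 x
      rw [h₁.laplaceOp_eq_toReal_erlangOp l hb h0, h₂.laplaceOp_eq_toReal_erlangOp l hb h0] at this
      rw [hA']
      exact (ENNReal.toReal_le_toReal (h₁.erlangOp_toKernel_ne_top hl hb x)
        (h₂.erlangOp_toKernel_ne_top hl hb x)).1 this
    have hae : ∀ x A, MeasurableSet A →
        ∀ᵐ t ∂volume.restrict (Set.Ioi (0 : ℝ)), κ₁ (t, x) A ≤ κ₂ (t, x) A := by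
      intro x A hA
      have hm : ∀ κ : Kernel (ℝ × E) E, Measurable fun t => κ (t, x) A := fun κ =>
        (κ.measurable_coe hA).comp (measurable_id.prodMk measurable_const)
      refine ae_le_of_forall_lintegral_erlangWeight_le (hm κ₁) (hm κ₂) M
        (fun t => (measure_mono (Set.subset_univ A)).trans (h₁.toKernel_univ_le _))
        (fun t => (measure_mono (Set.subset_univ A)).trans (h₂.toKernel_univ_le _))
        fun l hl n => ?_
      simpa [erlangOp, lintegral_indicator_one hA] using
        erlangOp_le_of_zero_le h₁.toKernel_add h₂.toKernel_add (hzero l hl) n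
          (measurable_one.indicator hA) x
    have hgood : ∀ᵐ t ∂volume.restrict (Set.Ioi (0 : ℝ)), ∀ x, k₁ t x ≤ k₂ t x := by
      obtain ⟨D, hDc, hD⟩ := TopologicalSpace.exists_countable_dense E
      have hTc := Set.countable_ofPred_finite_subset (TopologicalSpace.countable_countableBasis E)
      have hall : ∀ᵐ t ∂volume.restrict (Set.Ioi (0 : ℝ)), ∀ y ∈ D,
          ∀ T ∈ {T : Set (Set E) | T.Finite ∧ T ⊆ TopologicalSpace.countableBasis E},
            κ₁ (t, y) (⋃₀ T) ≤ κ₂ (t, y) (⋃₀ T) := by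
        refine (ae_ball_iff hDc).2 fun y _ => (ae_ball_iff hTc).2 fun T hT => hae y _ ?_
        exact (isOpen_sUnion fun U hU =>
          TopologicalSpace.isOpen_of_mem_countableBasis (hT.2 hU)).measurableSet
      filter_upwards [hall, ae_restrict_mem measurableSet_Ioi] with t ht htpos
      have htpos : 0 < t := htpos
      have := h₁.isFiniteMeasure htpos
      have := h₂.isFiniteMeasure htpos
      refine measure_le_of_dense (hc₁ t htpos) (hc₂ t htpos) hD fun y hy => ?_
      refine measure_le_of_forall_finite_sUnion_countableBasis_le fun T hT hTb => ?_
      rw [← h₁.toKernel_apply htpos, ← h₂.toKernel_apply htpos]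
      exact ht y hy T ⟨hT, hTb⟩
    intro t ht x A hA
    obtain ⟨r, s, hr, hs, rfl, hPr, hPs⟩ := exists_pos_add_eq_of_ae_Ioi hgood ht
    rw [h₁.2.2.1 r hr s hs x A hA, h₂.2.2.1 r hr s hs x A hA]
    exact lintegral_mono' (hPr x) fun y => hPs y A
  · intro h l hl f hf hf0 x
    rw [h₁.laplaceOp_eq_toReal_erlangOp l hf hf0, h₂.laplaceOp_eq_toReal_erlangOp l hf hf0]
    refine ENNReal.toReal_mono (h₂.erlangOp_toKernel_ne_top hl hf x) ?_
    refine setLIntegral_mono' measurableSet_Ioi fun t ht => mul_le_mul' le_rfl ?_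
    rw [h₁.toKernel_apply ht, h₂.toKernel_apply ht]
    exact lintegral_mono' (Measure.le_iff.2 fun A hA => h t ht x A hA) le_rfl
end

section
/- Let E = (0,1] and for t > 0 and f ∈ B_b((0,1]) define (T(t)f)(x) = f(x−t) if x > t and 0 if x ≤ t, and for n ≥ 1 define (T_n(t)f)(x) = ((x−t)/x)^{1/n} f(x−t) if x > t and 0 if x ≤ t. Then: (a) for every f ∈ B_b((0,1]) with f ≥ 0, every t > 0 and every x ∈ (0,1], the sequence ((T_n(t)f)(x))_{n≥1} is nondecreasing and converges to (T(t)f)(x) as n → ∞; (b) for every t ∈ (0,1) there exists f ∈ C_b((0,1]) such that T(t)f is not continuous on (0,1]; and (c) for every λ > 0, every f ∈ B_b((0,1]) and every x ∈ (0,1] one has ∫_0^∞ e^{−λt} (T(t)f)(x) dt = e^{−λx} ∫_0^x e^{λs} f(s) ds, and the function x ↦ e^{−λx} ∫_0^x e^{λs} f(s) ds is bounded and continuous on (0,1]. -/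
open MeasureTheory Filter Topology

/-- The Polish space `E = (0,1]` as a subtype of `ℝ`. -/
abbrev E01 : Type := {x : ℝ // x ∈ Set.Ioc (0:ℝ) 1}

/-- Right translation `x ↦ x - t` inside `(0,1]`. -/
def shift01 (x : E01) (t : ℝ) (ht : 0 < t) (htx : t < (x : ℝ)) : E01 :=
  ⟨(x : ℝ) - t, Set.mem_Ioc.mpr ⟨by linarith, by have h := x.2.2; linarith⟩⟩

/-- The semigroup `(T_n(t)f)(x) = ((x-t)/x)^{1/n} f(x-t)` for `x > t`, and `0` otherwise. -/
noncomputable def Tn01 (n : ℕ) (t : ℝ) (f : E01 → ℝ) (x : E01) : ℝ :=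
  if h : 0 < t ∧ t < (x : ℝ) then
    (((x : ℝ) - t) / (x : ℝ)) ^ ((1 : ℝ) / (n : ℝ)) * f (shift01 x t h.1 h.2)
  else 0
/-- The unweighted translation semigroup `(T(t)f)(x) = f(x-t)` for `x > t`, `0`
otherwise, on `(0,1]`. -/
noncomputable def T01 (t : ℝ) (f : E01 → ℝ) (x : E01) : ℝ :=
  if h : 0 < t ∧ t < (x : ℝ) then f (shift01 x t h.1 h.2) else 0

/-- Extension of a function on `(0,1]` by zero to all of `ℝ`. -/
noncomputable def ext01 (f : E01 → ℝ) : ℝ → ℝ :=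
  fun s => if h : s ∈ Set.Ioc (0:ℝ) 1 then f ⟨s, h⟩ else 0

lemma measurable_ext01 {f : E01 → ℝ} (hf : Measurable f) : Measurable (ext01 f) :=
  Measurable.dite hf measurable_const measurableSet_Ioc

lemma abs_ext01_le {f : E01 → ℝ} {C : ℝ} (hC : ∀ x, |f x| ≤ C) (s : ℝ) : |ext01 f s| ≤ C := by
  unfold ext01
  split_ifs with h
  · exact hC _
  · simpa using (abs_nonneg _).trans (hC ⟨1, by simp⟩)

lemma T01_eq_indicator (f : E01 → ℝ) (x : E01) (t : ℝ) :
    T01 t f x = (Set.Ioo 0 (x : ℝ)).indicator (fun t => ext01 f (x - t)) t := by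
  by_cases h : 0 < t ∧ t < (x : ℝ)
  · have hm : (x : ℝ) - t ∈ Set.Ioc (0 : ℝ) 1 := (shift01 x t h.1 h.2).2
    rw [Set.indicator_of_mem (show t ∈ Set.Ioo 0 (x : ℝ) from h)]
    simp only [T01, ext01, dif_pos h, dif_pos hm]
    rfl
  · rw [Set.indicator_of_notMem (show t ∉ Set.Ioo 0 (x : ℝ) from h)]
    simp only [T01, dif_neg h]

lemma intervalIntegrable_exp_mul_ext01 {f : E01 → ℝ} (hf : IsBb f) (l a b : ℝ) :
    IntervalIntegrable (fun s => Real.exp (l * s) * ext01 f s) volume a b := by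
  obtain ⟨hm, C, hC⟩ := hf
  have hexp : IntervalIntegrable (fun s => Real.exp (l * s)) volume a b :=
    (by fun_prop : Continuous fun s => Real.exp (l * s)).intervalIntegrable a b
  have hbd : ∀ s, ‖ext01 f s‖ ≤ C := abs_ext01_le hC
  rw [intervalIntegrable_iff] at hexp ⊢
  exact hexp.mul_bdd (measurable_ext01 hm).aestronglyMeasurable (Eventually.of_forall hbd)

lemma setIntegral_Ioo_eq_intervalIntegral (g : ℝ → ℝ) (x : E01) :
    ∫ s in Set.Ioo (0 : ℝ) (x : ℝ), g s = ∫ s in (0 : ℝ)..x, g s := by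
  rw [intervalIntegral.integral_of_le x.2.1.le, integral_Ioc_eq_integral_Ioo]

/-- The Laplace transform of the translation semigroup. -/
lemma integral_exp_mul_T01 (f : E01 → ℝ) (l : ℝ) (x : E01) :
    ∫ t in Set.Ioi (0 : ℝ), Real.exp (-l * t) * T01 t f x =
      Real.exp (-l * (x : ℝ)) *
        ∫ s in Set.Ioo (0 : ℝ) (x : ℝ), Real.exp (l * s) * ext01 f s := by
  have hind : (fun t => Real.exp (-l * t) * T01 t f x) =
      (Set.Ioo 0 (x : ℝ)).indicator (fun t => Real.exp (-l * t) * ext01 f (x - t)) := by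
    funext t
    rw [T01_eq_indicator, Set.indicator_mul_right]
  have hsub := intervalIntegral.integral_comp_sub_left (a := 0) (b := x)
    (fun s => Real.exp (-l * (x - s)) * ext01 f s) x
  simp only [sub_sub_cancel, sub_self, sub_zero] at hsub
  rw [hind, setIntegral_indicator measurableSet_Ioo,
    Set.inter_eq_right.mpr Set.Ioo_subset_Ioi_self, setIntegral_Ioo_eq_intervalIntegral,
    setIntegral_Ioo_eq_intervalIntegral, hsub, ← intervalIntegral.integral_const_mul]
  congr 1
  funext s
  rw [← mul_assoc, ← Real.exp_add]
  ring_nf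

/-- The resolvent of the translation semigroup is strong Feller. -/
lemma isCb_resolvent {f : E01 → ℝ} (hf : IsBb f) {l : ℝ} (hl : 0 < l) :
    IsCb (fun x : E01 => Real.exp (-l * (x : ℝ)) *
      ∫ s in Set.Ioo (0 : ℝ) (x : ℝ), Real.exp (l * s) * ext01 f s) := by
  simp only [setIntegral_Ioo_eq_intervalIntegral]
  constructor
  · have h := (intervalIntegral.continuous_primitive
      (intervalIntegrable_exp_mul_ext01 hf l) 0).comp (continuous_subtype_val : Continuous
        (Subtype.val : E01 → ℝ))
    exact (by fun_prop : Continuous fun x : E01 => Real.exp (-l * (x : ℝ))).mul h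
  · obtain ⟨-, C, hC⟩ := hf
    have hC0 : 0 ≤ C := (abs_nonneg _).trans (hC ⟨1, by simp⟩)
    refine ⟨Real.exp l * C, fun x => ?_⟩
    have hx0 := x.2.1
    have hx1 := x.2.2
    have hint : ‖∫ s in (0 : ℝ)..x, Real.exp (l * s) * ext01 f s‖ ≤
        Real.exp l * C * |(x : ℝ) - 0| := by
      refine intervalIntegral.norm_integral_le_of_norm_le_const fun s hs => ?_
      rw [Set.uIoc_of_le hx0.le] at hs
      rw [norm_mul, Real.norm_eq_abs, Real.norm_eq_abs, Real.abs_exp]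
      gcongr
      · nlinarith [hs.2]
      · exact abs_ext01_le hC s
    rw [Real.norm_eq_abs, sub_zero, abs_of_pos hx0] at hint
    rw [abs_mul, Real.abs_exp]
    have hexp : Real.exp (-l * x) ≤ 1 := Real.exp_le_one_iff.mpr (by nlinarith)
    calc _ ≤ 1 * (Real.exp l * C * x) := by gcongr
      _ ≤ 1 * (Real.exp l * C * 1) := by gcongr
      _ = _ := by ring

lemma not_continuous_T01_one {t : ℝ} (ht0 : 0 < t) (ht1 : t < 1) :
    ¬ Continuous (T01 t (fun _ => 1)) := by
  intro hcont
  obtain ⟨δ, hδ, h⟩ := Metric.continuous_iff.mp hcont ⟨t, ht0, ht1.le⟩ 1 one_pos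
  have hε : 0 < min (δ / 2) (1 - t) := lt_min (by linarith) (by linarith)
  have hε1 := min_le_left (δ / 2) (1 - t)
  have hε2 := min_le_right (δ / 2) (1 - t)
  set ε := min (δ / 2) (1 - t)
  have h' := h ⟨t + ε, by linarith, by linarith⟩ (by
    rw [Subtype.dist_eq, Real.dist_eq, add_sub_cancel_left, abs_of_pos hε]
    linarith)
  simp [T01, ht0, hε] at h'

lemma Tn01_mono {f : E01 → ℝ} (hf : ∀ x, 0 ≤ f x) (t : ℝ) (x : E01) {m k : ℕ} (hm : 1 ≤ m)
    (hmk : m ≤ k) : Tn01 m t f x ≤ Tn01 k t f x := by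
  unfold Tn01
  split_ifs with h
  · have hx := x.2.1
    refine mul_le_mul_of_nonneg_right ?_ (hf _)
    refine Real.rpow_le_rpow_of_exponent_ge (div_pos (by linarith [h.2]) hx)
      ((div_le_one hx).mpr (by linarith [h.1])) ?_
    have : (0 : ℝ) < m := by exact_mod_cast hm
    gcongr
  · exact le_rfl

lemma tendsto_Tn01 (f : E01 → ℝ) (t : ℝ) (x : E01) :
    Tendsto (fun n => Tn01 n t f x) atTop (𝓝 (T01 t f x)) := by
  unfold Tn01 T01
  split_ifs with h
  · have hpos : 0 < ((x : ℝ) - t) / x := div_pos (by linarith [h.2]) x.2.1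
    have hpow := (Real.continuousAt_const_rpow hpos.ne' (b := 0)).tendsto.comp
      (tendsto_one_div_atTop_nhds_zero_nat (𝕜 := ℝ))
    simpa using hpow.mul_const (f (shift01 x t h.1 h.2))
  · exact tendsto_const_nhds

/-- On `(0,1]`: the semigroups `T_n` increase to the translation semigroup `T`
(for nonnegative bounded measurable functions); `T` does not leave `C_b((0,1])`
invariant; yet the Laplace transform of `T` is given by
`(R(λ)f)(x) = e^{-λx} ∫_0^x e^{λs} f(s) ds` and maps `B_b((0,1])` into
`C_b((0,1])`. -/
theorem T01_limit_and_laplace :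
    -- (a) monotone convergence of T_n to T
    (∀ f : E01 → ℝ, IsBb f → (∀ x, 0 ≤ f x) → ∀ t : ℝ, 0 < t → ∀ x : E01,
      (∀ m k : ℕ, 1 ≤ m → m ≤ k → Tn01 m t f x ≤ Tn01 k t f x) ∧
      Tendsto (fun m => Tn01 m t f x) atTop (𝓝 (T01 t f x))) ∧
    -- (b) T does not leave C_b((0,1]) invariant
    (∀ t : ℝ, 0 < t → t < 1 →
      ∃ f : E01 → ℝ, IsCb f ∧ ¬ Continuous (T01 t f)) ∧
    -- (c) the Laplace transform of T and its strong Feller property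
    (∀ l : ℝ, 0 < l → ∀ f : E01 → ℝ, IsBb f →
      (∀ x : E01,
        (∫ t in Set.Ioi (0 : ℝ), Real.exp (-l * t) * T01 t f x) =
          Real.exp (-l * (x : ℝ)) *
            ∫ s in Set.Ioo (0 : ℝ) (x : ℝ), Real.exp (l * s) * ext01 f s) ∧
      IsCb (fun x : E01 => Real.exp (-l * (x : ℝ)) *
        ∫ s in Set.Ioo (0 : ℝ) (x : ℝ), Real.exp (l * s) * ext01 f s)) := by
  refine ⟨fun f _ hf t _ x => ⟨fun _ _ => Tn01_mono hf t x, tendsto_Tn01 f t x⟩,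
    fun t ht0 ht1 => ⟨fun _ => 1, ⟨continuous_const, 1, by simp⟩, not_continuous_T01_one ht0 ht1⟩,
    fun l hl f hf => ⟨integral_exp_mul_T01 f l, isCb_resolvent hf hl⟩⟩
end
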